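/- Let d ≥ 2, h > 0, and let φ ∈ C₀^∞(ℝ^d) be real. Then for the whole-space operator H₀ = −h²Δ − 1 on L²(ℝ^d), Tr(φ H₀ φ)_− ≥ L_d h^{−d} ∫_{ℝ^d} φ(x)² dx − (2π)^{−d} ω_d h^{−d+2} ∫_{ℝ^d} |∇φ(x)|² dx. Combined with the upper bound Tr(φH₀φ)_− ≤ L_d h^{−d} ∫ φ², this gives | Tr(φH₀φ)_− − L_d h^{−d} ∫ φ² | ≤ (2π)^{−d} ω_d h^{−d+2} ∫ |∇φ|². -/

import Mathlib

open MeasureTheory Real Metric Set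

noncomputable section

abbrev Euc (d : ℕ) := EuclideanSpace ℝ (Fin d)

/-- Volume of the unit ball in ℝ^d. -/
noncomputable def ballVol (d : ℕ) : ℝ := (volume (Metric.ball (0 : Euc d) 1)).toReal

/-- The semiclassical constant L_d = 2 ω_d / ((d+2)(2π)^d). -/
noncomputable def Lconst (d : ℕ) : ℝ := 2 * ballVol d / ((d + 2) * (2 * π) ^ d)

/-- Smooth real function compactly supported in the open set U. -/
def TestFun {d : ℕ} (U : Set (Euc d)) (v : Euc d → ℝ) : Prop :=
  ContDiff ℝ (⊤ : ℕ∞) v ∧ HasCompactSupport v ∧ tsupport v ⊆ U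

/-- `trNeg U h φ` is Tr(φ H_U φ)_-, the sum of absolute values of the negative
eigenvalues of φ(-h²Δ_U - 1)φ, expressed by the variational principle as the
supremum, over finite L²-orthonormal families of test functions in U, of
Σ_j (∫ φ² v_j² - h² ∫ |∇(φ v_j)|²). -/
noncomputable def trNeg {d : ℕ} (U : Set (Euc d)) (h : ℝ) (φ : Euc d → ℝ) : ℝ :=
  sSup { S : ℝ | ∃ (n : ℕ) (v : Fin n → Euc d → ℝ),
    (∀ i, TestFun U (v i)) ∧
    (∀ i j, (∫ x : Euc d, v i x * v j x) = if i = j then (1:ℝ) else 0) ∧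
    S = ∑ j, ((∫ x : Euc d, (φ x)^2 * (v j x)^2)
          - h^2 * ∫ x : Euc d, ‖gradient (fun y => φ y * v j y) x‖^2) }

/-- Tr(H_Ω)_- for H_Ω = -h²Δ_Ω - 1. -/
noncomputable def trNegH {d : ℕ} (Ω : Set (Euc d)) (h : ℝ) : ℝ :=
  trNeg Ω h (fun _ => 1)

/-- d(u): the distance from u to the complement of Ω. -/
noncomputable def distOut {d : ℕ} (Ω : Set (Euc d)) (u : Euc d) : ℝ :=
  Metric.infDist u Ωᶜ

/-- The local length scale l(u) = ½(1 + (d(u)² + l₀²)^{-1/2})⁻¹. -/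
noncomputable def lfun {d : ℕ} (Ω : Set (Euc d)) (l₀ : ℝ) (u : Euc d) : ℝ :=
  (1/2) * (1 + (Real.sqrt ((distOut Ω u)^2 + l₀^2))⁻¹)⁻¹

theorem hasCompactSupport_sq {d : ℕ} {u : Euc d → ℝ} (hu : HasCompactSupport u) :
    HasCompactSupport fun x => u x ^ 2 :=
  hu.mono fun x hx => by
    contrapose! hx
    rw [Function.mem_support, not_not] at hx ⊢
    rw [hx, zero_pow two_ne_zero]

/-- A finite family whose Gram matrix for the positive definite form `B` is at most `1` can be
replaced by a `B`-orthonormal family without decreasing `∑ Q (v, v)`. -/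
theorem exists_orthonormal_family_sum_le {V : Type*} [AddCommGroup V] [Module ℝ V]
    (B Q : V →ₗ[ℝ] V →ₗ[ℝ] ℝ) (hsymm : ∀ f g, B f g = B g f)
    (hpos : ∀ f, 0 ≤ B f f) (hdef : ∀ f, B f f = 0 → f = 0)
    {ι : Type*} [Fintype ι] [DecidableEq ι] (g : ι → V)
    (hg : ∀ c : ι → ℝ, B (∑ k, c k • g k) (∑ k, c k • g k) ≤ ∑ k, c k ^ 2) :
    ∃ (n : ℕ) (v : Fin n → V), (∀ i j, B (v i) (v j) = if i = j then 1 else 0) ∧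
      ∑ k, Q (g k) (g k) ≤ ∑ j, Q (v j) (v j) := by
  set G : Matrix ι ι ℝ := Matrix.of fun k l => B (g k) (g l) with hGdef
  have hG : G.IsHermitian := by
    ext i j
    simp [hGdef, hsymm (g j)]
  set b := hG.eigenvectorBasis with hb
  set w : ι → V := fun j => ∑ k, b j k • g k with hw
  have expand : ∀ (A : V →ₗ[ℝ] V →ₗ[ℝ] ℝ) i j,
      A (w i) (w j) = ∑ k, ∑ l, b i k * b j l * A (g k) (g l) := by
    intro A i j
    simp only [hw, map_sum, LinearMap.sum_apply, map_smul, LinearMap.smul_apply, smul_eq_mul]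
    simp_rw [Finset.mul_sum]
    rw [Finset.sum_comm]
    refine Finset.sum_congr rfl fun k _ => ?_
    exact Finset.sum_congr rfl fun l _ => by ring
  have orth : ∀ i j, ∑ k, b i k * b j k = if i = j then 1 else 0 := by
    intro i j
    have := orthonormal_iff_ite.mp b.orthonormal i j
    rw [← this]
    simp [PiLp.inner_apply, mul_comm]
  have orth' : ∀ k l, ∑ j, b j k * b j l = if k = l then 1 else 0 := by
    intro k l
    have h1 : (Matrix.of fun i k => b i k) * (Matrix.of fun i k => b i k : Matrix ι ι ℝ).transpose = 1 := by
      ext i j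
      simp [Matrix.mul_apply, orth, Matrix.one_apply]
    have h2 : _ = (1 : Matrix ι ι ℝ) k l := congrArg (fun M => M k l) (mul_eq_one_comm.mp h1)
    simpa [Matrix.mul_apply, Matrix.one_apply] using h2
  have wB : ∀ i j, B (w i) (w j) = if i = j then hG.eigenvalues j else 0 := by
    intro i j
    have h1 : ∀ k, ∑ l, B (g k) (g l) * b j l = hG.eigenvalues j * b j k := by
      intro k
      have := congrFun (hG.mulVec_eigenvectorBasis j) k
      simpa [Matrix.mulVec, dotProduct, hGdef] using this
    rw [expand]
    have : ∀ k, ∑ l, b i k * b j l * B (g k) (g l) = hG.eigenvalues j * (b i k * b j k) := by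
      intro k
      calc _ = b i k * ∑ l, B (g k) (g l) * b j l := by
            rw [Finset.mul_sum]; exact Finset.sum_congr rfl fun l _ => by ring
        _ = _ := by rw [h1]; ring
    simp_rw [this]
    rw [← Finset.mul_sum, orth]
    split_ifs <;> simp
  have wQ : ∑ j, Q (w j) (w j) = ∑ k, Q (g k) (g k) := by
    simp_rw [expand]
    rw [Finset.sum_comm]
    refine Finset.sum_congr rfl fun k _ => ?_
    rw [Finset.sum_comm]
    simp_rw [← Finset.sum_mul, orth']
    simp
  have ev_nonneg : ∀ j, 0 ≤ hG.eigenvalues j := fun j => by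
    have := hpos (w j); rw [wB] at this; simpa using this
  have ev_le : ∀ j, hG.eigenvalues j ≤ 1 := fun j => by
    have h1 := hg (fun k => b j k)
    have h2 := wB j j
    have h3 := orth j j
    simp only [if_true] at h2 h3
    simp only [pow_two] at h1
    rw [h3] at h1
    rw [← h2]
    exact h1
  let J := {j : ι // 0 < hG.eigenvalues j ∧ 0 < Q (w j) (w j)}
  classical
  let e : J ≃ Fin (Fintype.card J) := Fintype.equivFin J
  let v : J → V := fun j => (√(hG.eigenvalues j))⁻¹ • w j
  refine ⟨Fintype.card J, v ∘ e.symm, fun i j => ?_, ?_⟩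
  · simp only [Function.comp, v, map_smul, LinearMap.smul_apply, smul_eq_mul, wB]
    by_cases hij : i = j
    · subst hij
      have := (e.symm i).2.1
      simp only [if_true]
      have h2 := Real.mul_self_sqrt this.le
      have h3 := (Real.sqrt_pos.mpr this).ne'
      field_simp
      rw [pow_two, h2]
    · have : (e.symm i : ι) ≠ e.symm j := fun h => hij (e.symm.injective (Subtype.ext h))
      simp [hij, this]
  · simp only [Function.comp_apply]
    rw [← wQ, Equiv.sum_comp e.symm (fun j => Q (v j) (v j))]
    rw [← Finset.sum_filter_add_sum_filter_not Finset.univ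
      (fun j => 0 < hG.eigenvalues j ∧ 0 < Q (w j) (w j))]
    have h1 : ∑ j with ¬ (0 < hG.eigenvalues j ∧ 0 < Q (w j) (w j)), Q (w j) (w j) ≤ 0 := by
      refine Finset.sum_nonpos fun j hj => ?_
      rw [Finset.mem_filter] at hj
      by_contra hc
      push Not at hc
      refine hj.2 ⟨(ev_nonneg j).lt_of_ne fun h0 => ?_, hc⟩
      have := hdef (w j) (by rw [wB]; simp [← h0])
      simp [this] at hc
    have h2 : ∑ j with (0 < hG.eigenvalues j ∧ 0 < Q (w j) (w j)), Q (w j) (w j)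
        = ∑ j : J, Q (w j) (w j) :=
      Finset.sum_subtype _ (by simp) _
    rw [h2]
    have h3 : ∑ j : J, Q (w j) (w j) ≤ ∑ j : J, Q (v j) (v j) := by
      refine Finset.sum_le_sum fun j _ => ?_
      simp only [v, map_smul, LinearMap.smul_apply, smul_eq_mul]
      rw [← mul_assoc, ← mul_inv, Real.mul_self_sqrt j.2.1.le]
      exact le_mul_of_one_le_left j.2.2.le ((one_le_inv₀ j.2.1).mpr (ev_le j))
    linarith

/-- The `n`-periodic plane waves are orthogonal on a cube of side `n`. -/
theorem integral_cube_planeWave {d n : ℕ} (hn : 0 < n) (ξ : Fin d → ℝ)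
    (hξ : ∀ i, ∃ m : ℤ, n * ξ i = m) :
    ∫ x in Set.univ.pi fun _ : Fin d => Set.Ioc (-(n:ℝ) / 2) (n / 2),
      Complex.exp ((2 * π * ∑ i, x i * ξ i : ℝ) * Complex.I) =
      if ξ = 0 then (n : ℂ) ^ d else 0 := by
  have hn' : (n : ℝ) ≠ 0 := by positivity
  rw [volume_pi, Measure.restrict_pi_pi]
  have h1 : ∀ x : Fin d → ℝ, Complex.exp ((2 * π * ∑ i, x i * ξ i : ℝ) * Complex.I)
      = ∏ i, Complex.exp ((2 * π * ξ i) * Complex.I * x i) := by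
    intro x
    rw [← Complex.exp_sum]
    congr 1
    push_cast
    rw [Finset.mul_sum, Finset.sum_mul]
    exact Finset.sum_congr rfl fun i _ => by ring
  simp_rw [h1]
  rw [integral_fintype_prod_eq_prod
    (f := fun i (t : ℝ) => Complex.exp ((2 * π * ξ i) * Complex.I * t))]
  have hle : -(n:ℝ) / 2 ≤ n / 2 := by
    have : (0:ℝ) ≤ n := by positivity
    linarith
  have h2 : ∀ i, ∫ t in Set.Ioc (-(n:ℝ) / 2) (n / 2), Complex.exp ((2 * π * ξ i) * Complex.I * t)
      = if ξ i = 0 then (n : ℂ) else 0 := by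
    intro i
    rw [← intervalIntegral.integral_of_le hle]
    split_ifs with h0
    · simp [h0]
      ring
    · have hc : (2 * π * ξ i) * Complex.I ≠ 0 := by
        simp [h0, Real.pi_ne_zero]
      rw [integral_exp_mul_complex hc]
      obtain ⟨m, hm⟩ := hξ i
      have hm' : (n : ℂ) * ξ i = m := by exact_mod_cast hm
      have : Complex.exp ((2 * π * ξ i) * Complex.I * ((n / 2 : ℝ) : ℂ))
          = Complex.exp ((2 * π * ξ i) * Complex.I * ((-n / 2 : ℝ) : ℂ)) := by
        rw [Complex.exp_eq_exp_iff_exists_int]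
        refine ⟨m, ?_⟩
        push_cast
        rw [← hm']
        ring
      rw [this]; simp
  simp_rw [h2]
  split_ifs with h
  · simp [h]
  · obtain ⟨i, hi⟩ := Function.ne_iff.mp h
    exact Finset.prod_eq_zero (Finset.mem_univ i) (if_neg hi)

theorem integral_cube_norm_sq_sum_planeWave {d n : ℕ} (hn : 0 < n) (T : Finset (Fin d → ℝ))
    (hT : ∀ ξ ∈ T, ∀ i, ∃ m : ℤ, n * ξ i = m) (c : (Fin d → ℝ) → ℂ) :
    ∫ x in Set.univ.pi fun _ : Fin d => Set.Ioc (-(n:ℝ) / 2) (n / 2),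
      ‖∑ ξ ∈ T, c ξ * Complex.exp ((2 * π * ∑ i, x i * ξ i : ℝ) * Complex.I)‖ ^ 2 =
      n ^ d * ∑ ξ ∈ T, ‖c ξ‖ ^ 2 := by
  apply Complex.ofReal_injective
  rw [← integral_complex_ofReal]
  have h1 : ∀ x : Fin d → ℝ,
      ((‖∑ ξ ∈ T, c ξ * Complex.exp ((2 * π * ∑ i, x i * ξ i : ℝ) * Complex.I)‖ ^ 2 : ℝ) : ℂ)
      = ∑ ξ ∈ T, ∑ η ∈ T, (c ξ * (starRingEnd ℂ) (c η)) *
        Complex.exp ((2 * π * ∑ i, x i * (ξ - η) i : ℝ) * Complex.I) := by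
    intro x
    rw [Complex.ofReal_pow, ← Complex.mul_conj', map_sum, Finset.sum_mul_sum]
    refine Finset.sum_congr rfl fun ξ _ => Finset.sum_congr rfl fun η _ => ?_
    rw [map_mul, ← Complex.exp_conj, mul_mul_mul_comm, ← Complex.exp_add]
    have h2 : ∑ i, x i * (ξ - η) i = ∑ i, x i * ξ i - ∑ i, x i * η i := by
      simp [mul_sub]
    rw [h2]
    congr 2
    rw [map_mul, Complex.conj_I, Complex.conj_ofReal]
    push_cast
    ring
  have hint : ∀ ζ : Fin d → ℝ, IntegrableOn
      (fun x : Fin d → ℝ => Complex.exp ((2 * π * ∑ i, x i * ζ i : ℝ) * Complex.I))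
      (Set.univ.pi fun _ : Fin d => Set.Ioc (-(n:ℝ) / 2) (n / 2)) := by
    intro ζ
    refine IntegrableOn.mono_set (t := Set.univ.pi fun _ : Fin d => Set.Icc (-(n:ℝ) / 2) (n / 2))
      ?_ (Set.pi_mono fun _ _ => Set.Ioc_subset_Icc_self)
    refine ContinuousOn.integrableOn_compact (isCompact_univ_pi fun _ => isCompact_Icc) ?_
    fun_prop
  simp_rw [h1]
  rw [integral_finsetSum _ fun ξ _ => integrable_finsetSum _ fun η _ => (hint _).const_mul _]
  rw [Complex.ofReal_mul, Complex.ofReal_sum, Finset.mul_sum]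
  refine Finset.sum_congr rfl fun ξ hξ => ?_
  rw [integral_finsetSum _ fun η _ => (hint _).const_mul _]
  rw [Finset.sum_eq_single ξ]
  · rw [integral_const_mul, integral_cube_planeWave hn _ (fun i => ⟨0, by simp⟩), Complex.mul_conj']
    simp [mul_comm]
  · intro η hη hne
    rw [integral_const_mul, integral_cube_planeWave hn _ (fun i => ?_), if_neg, mul_zero]
    · exact sub_ne_zero.mpr hne.symm
    · obtain ⟨a, ha⟩ := hT ξ hξ i
      obtain ⟨b, hb⟩ := hT η hη i
      exact ⟨a - b, by push_cast; rw [← ha, ← hb, Pi.sub_apply]; ring⟩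
  · exact fun h => absurd hξ h

open scoped Pointwise in
/-- Riemann sums of a continuous function over the points of a ball lying in `n⁻¹ ℤ^d`. -/
theorem exists_tendsto_sum_lattice_ball {d : ℕ} (R : ℝ) (c : Euc d → ℝ) (hc : Continuous c) :
    ∃ T : ℕ → Finset (Fin d → ℝ), (∀ n, 0 < n → ∀ ξ ∈ T n, ∀ i, ∃ m : ℤ, n * ξ i = m) ∧
      Filter.Tendsto (fun n : ℕ => (∑ ξ ∈ T n, c (WithLp.toLp 2 ξ)) / (n : ℝ) ^ d) Filter.atTop
        (nhds (∫ ξ in ball (0 : Euc d) R, c ξ)) := by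
  set e := (PiLp.continuousLinearEquiv 2 ℝ (fun _ : Fin d => ℝ)).symm with he
  set s : Set (Fin d → ℝ) := e ⁻¹' ball 0 R with hs
  have hopen : IsOpen s := isOpen_ball.preimage e.continuous
  have hconv : Convex ℝ s := (convex_ball (0 : Euc d) R).linear_preimage e.toLinearEquiv.toLinearMap
  have hbdd : Bornology.IsBounded s := by
    have h1 : s = e.symm '' ball 0 R := by
      rw [hs, ContinuousLinearEquiv.image_symm_eq_preimage]
    rw [h1]
    exact e.symm.lipschitz.isBounded_image isBounded_ball
  have hfr : volume (frontier s) = 0 := hconv.addHaar_frontier volume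
  have hlim := tendsto_tsum_div_pow_atTop_integral s (fun ξ => c (WithLp.toLp 2 ξ)) (by fun_prop)
    hbdd hopen.measurableSet hfr
  have hint : ∫ ξ in s, c (WithLp.toLp 2 ξ) = ∫ ξ in ball (0 : Euc d) R, c ξ :=
    (PiLp.volume_preserving_toLp (Fin d)).setIntegral_preimage_emb
      (MeasurableEquiv.toLp 2 (Fin d → ℝ)).measurableEmbedding c (ball 0 R)
  rw [hint] at hlim
  let L : Submodule ℤ (Fin d → ℝ) := Submodule.span ℤ (Set.range (Pi.basisFun ℝ (Fin d)))
  have hfin : ∀ n : ℕ, 0 < n →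
      (s ∩ (((n : ℝ)⁻¹ • L : Submodule ℤ (Fin d → ℝ)) : Set (Fin d → ℝ))).Finite := by
    intro n hn
    have hn' : (n : ℝ)⁻¹ ≠ 0 := by positivity
    rw [ZSpan.smul _ hn']
    exact ZSpan.setFinite_inter _ hbdd
  classical
  refine ⟨fun n => if hn : 0 < n then (hfin n hn).toFinset else ∅, fun n hn ξ hξ i => ?_, ?_⟩
  · simp only [dif_pos hn] at hξ
    rw [Set.Finite.mem_toFinset] at hξ
    have : NeZero n := ⟨hn.ne'⟩
    obtain ⟨m, hm⟩ := (BoxIntegral.unitPartition.mem_smul_span_iff (n := n)).mp hξ.2 i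
    exact ⟨m, by simpa using hm.symm⟩
  · refine hlim.congr' ?_
    filter_upwards [Filter.eventually_gt_atTop 0] with n hn
    simp only [dif_pos hn]
    rw [Fintype.card_fin]
    congr 1
    have := (hfin n hn).fintype
    have h2 : (s ∩ (n : ℝ)⁻¹ • (L : Set (Fin d → ℝ)))
      = (s ∩ (((n : ℝ)⁻¹ • L : Submodule ℤ (Fin d → ℝ)) : Set (Fin d → ℝ))) := by
      rw [Submodule.coe_pointwise_smul]
    have h3 := Finset.tsum_subtype (hfin n hn).toFinset (fun ξ => c (WithLp.toLp 2 ξ))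
    rw [← h3]
    have h4 : ((hfin n hn).toFinset : Set (Fin d → ℝ)) = (s ∩ (n : ℝ)⁻¹ • (L : Set (Fin d → ℝ))) := by
      rw [Set.Finite.coe_toFinset, h2]
    exact (congrArg (fun S : Set (Fin d → ℝ) => ∑' ξ : S, c (WithLp.toLp 2 (ξ : Fin d → ℝ))) h4).symm

theorem volume_real_ball (d : ℕ) {R : ℝ} (hR : 0 < R) :
    (volume : Measure (Euc d)).real (ball 0 R) = ballVol d * R ^ d := by
  rw [Measure.real, Measure.addHaar_ball_of_pos _ _ hR, ENNReal.toReal_mul,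
    ENNReal.toReal_ofReal (by positivity), finrank_euclideanSpace_fin, ballVol, mul_comm]

theorem setIntegral_ball_norm_sq {d : ℕ} (hd : 0 < d) {R : ℝ} (hR : 0 < R) :
    ∫ ξ in ball (0 : Euc d) R, ‖ξ‖ ^ 2 = d / (d + 2) * ballVol d * R ^ (d + 2) := by
  have : Nontrivial (Euc d) := by
    have : Nonempty (Fin d) := ⟨⟨0, hd⟩⟩
    infer_instance
  have h1 : ∫ ξ in ball (0 : Euc d) R, ‖ξ‖ ^ 2
      = ∫ ξ : Euc d, (Set.Iio R).indicator (fun r : ℝ => r ^ 2) ‖ξ‖ := by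
    rw [← integral_indicator measurableSet_ball]
    refine integral_congr_ae (Filter.Eventually.of_forall fun ξ => ?_)
    simp [Set.indicator]
  rw [h1, integral_fun_norm_addHaar volume, finrank_euclideanSpace_fin]
  have h2 : ∀ y : ℝ, y ^ (d - 1) • (Set.Iio R).indicator (fun r : ℝ => r ^ 2) y
      = (Set.Iio R).indicator (fun r : ℝ => r ^ (d + 1)) y := by
    intro y
    by_cases hy : y ∈ Set.Iio R
    · simp only [Set.indicator_of_mem hy, smul_eq_mul, ← pow_add]
      congr 1; omega
    · simp [Set.indicator_of_notMem hy]
  simp_rw [h2]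
  rw [setIntegral_indicator measurableSet_Iio, Set.Ioi_inter_Iio, ← integral_Ioc_eq_integral_Ioo,
    ← intervalIntegral.integral_of_le hR.le, integral_pow, nsmul_eq_mul, smul_eq_mul, ballVol,
    Measure.real]
  push_cast
  rw [zero_pow (by omega)]
  field_simp
  ring

theorem setIntegral_ball_symbol {d : ℕ} (hd : 0 < d) {h : ℝ} (hh : 0 < h) :
    ∫ ξ in ball (0 : Euc d) (2 * π * h)⁻¹, (1 - 4 * π ^ 2 * h ^ 2 * ‖ξ‖ ^ 2) =
      Lconst d * h ^ (-(d : ℝ)) := by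
  have hR : 0 < (2 * π * h)⁻¹ := by positivity
  have hi : IntegrableOn (fun ξ : Euc d => ‖ξ‖ ^ 2) (ball 0 (2 * π * h)⁻¹) :=
    ((continuous_norm.pow 2).continuousOn.integrableOn_compact
      (isCompact_closedBall 0 (2 * π * h)⁻¹)).mono_set ball_subset_closedBall
  have h1 : IntegrableOn (fun _ : Euc d => (1 : ℝ)) (ball 0 (2 * π * h)⁻¹) :=
    integrableOn_const measure_ball_lt_top.ne
  rw [integral_sub h1 (hi.const_mul _),
    integral_const_mul, setIntegral_ball_norm_sq hd hR, setIntegral_const, volume_real_ball d hR,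
    Real.rpow_neg hh.le, Real.rpow_natCast, Lconst, smul_eq_mul]
  rw [inv_pow, inv_pow, mul_pow _ h, mul_pow _ h, pow_add (2 * π), pow_add h]
  field_simp
  ring

theorem norm_gradient_sq_eq_sum {d : ℕ} (u : Euc d → ℝ) (x : Euc d) :
    ‖gradient u x‖ ^ 2 = ∑ i, (fderiv ℝ u x (EuclideanSpace.single i 1)) ^ 2 := by
  rw [EuclideanSpace.norm_sq_eq]
  refine Finset.sum_congr rfl fun i _ => ?_
  have h1 : fderiv ℝ u x (EuclideanSpace.single i 1) = gradient u x i := by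
    rw [← inner_gradient_left, EuclideanSpace.inner_single_right]
    simp
  rw [h1, Real.norm_eq_abs, sq_abs]

open scoped SchwartzMap LineDeriv FourierTransform in
/-- Plancherel's identity for the quadratic form of `-h²Δ - 1`. -/
theorem plancherel_energy {d : ℕ} (h : ℝ) (u : Euc d → ℝ) (hu : ContDiff ℝ (⊤ : ℕ∞) u)
    (huc : HasCompactSupport u) :
    Integrable (fun ξ : Euc d => (1 - 4 * π ^ 2 * h ^ 2 * ‖ξ‖ ^ 2) *
      ((∫ x, u x * cos (2 * π * inner ℝ x ξ)) ^ 2 + (∫ x, u x * sin (2 * π * inner ℝ x ξ)) ^ 2)) ∧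
    (∫ x, (u x) ^ 2) - h ^ 2 * ∫ x, ‖gradient u x‖ ^ 2 =
      ∫ ξ : Euc d, (1 - 4 * π ^ 2 * h ^ 2 * ‖ξ‖ ^ 2) *
      ((∫ x, u x * cos (2 * π * inner ℝ x ξ)) ^ 2 + (∫ x, u x * sin (2 * π * inner ℝ x ξ)) ^ 2) := by
  have hcs : HasCompactSupport (fun x => (u x : ℂ)) := huc.comp_left Complex.ofReal_zero
  have hcd : ContDiff ℝ (⊤ : ℕ∞) (fun x => (u x : ℂ)) := Complex.ofRealCLM.contDiff.comp hu
  set f : 𝓢(Euc d, ℂ) := hcs.toSchwartzMap hcd with hf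
  have hfx : ∀ x, f x = (u x : ℂ) := fun x => rfl
  have hF : ∀ ξ, ‖𝓕 f ξ‖ ^ 2 = (∫ x, u x * cos (2 * π * inner ℝ x ξ)) ^ 2
      + (∫ x, u x * sin (2 * π * inner ℝ x ξ)) ^ 2 := by
    intro ξ
    have ic : Integrable (fun x => u x * cos (2 * π * inner ℝ x ξ)) :=
      (hu.continuous.mul (by fun_prop)).integrable_of_hasCompactSupport huc.mul_right
    have is : Integrable (fun x => u x * sin (2 * π * inner ℝ x ξ)) :=
      (hu.continuous.mul (by fun_prop)).integrable_of_hasCompactSupport huc.mul_right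
    have h1 : 𝓕 f ξ = ((∫ x, u x * cos (2 * π * inner ℝ x ξ) : ℝ) : ℂ)
        - ((∫ x, u x * sin (2 * π * inner ℝ x ξ) : ℝ) : ℂ) * Complex.I := by
      rw [SchwartzMap.fourier_coe, Real.fourier_eq', ← integral_complex_ofReal,
        ← integral_complex_ofReal, ← integral_mul_const, ← integral_sub ic.ofReal
        (is.ofReal.mul_const _)]
      refine integral_congr_ae (Filter.Eventually.of_forall fun x => ?_)
      simp only [hfx, smul_eq_mul]
      rw [Complex.exp_mul_I, ← Complex.ofReal_cos, ← Complex.ofReal_sin]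
      simp only [neg_mul, Real.cos_neg, Real.sin_neg]
      push_cast
      ring
    rw [h1, ← Complex.normSq_eq_norm_sq, Complex.normSq_apply]
    simp
    ring
  have integrable_norm_sq : ∀ g : 𝓢(Euc d, ℂ), Integrable fun x => ‖g x‖ ^ 2 := fun g => by
    have := (g.memLp 2 volume).integrable_norm_pow (by simp)
    simpa using this
  have hDpt : ∀ (i : Fin d) (ξ : Euc d), ‖𝓕 (∂_{(EuclideanSpace.single i 1 : Euc d)} f) ξ‖ ^ 2
      = (4 * π ^ 2 * (ξ i) ^ 2) * ‖𝓕 f ξ‖ ^ 2 := by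
    intro i ξ
    have hg : (fun y : Euc d => inner ℝ y (EuclideanSpace.single i 1 : Euc d)).HasTemperateGrowth :=
      ((innerSL ℝ).flip (EuclideanSpace.single i 1 : Euc d)).hasTemperateGrowth
    rw [SchwartzMap.fourier_lineDerivOp_eq, _root_.smul_apply,
      SchwartzMap.smulLeftCLM_apply_apply hg]
    simp only [EuclideanSpace.inner_single_right, norm_smul, norm_mul, mul_pow]
    simp
    ring
  have hD : ∀ i, ∫ ξ, ‖𝓕 (∂_{(EuclideanSpace.single i 1 : Euc d)} f) ξ‖ ^ 2
      = ∫ x, (fderiv ℝ u x (EuclideanSpace.single i 1)) ^ 2 := by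
    intro i
    rw [SchwartzMap.integral_norm_sq_fourier]
    refine integral_congr_ae (Filter.Eventually.of_forall fun x => ?_)
    have h2 : HasFDerivAt (fun x => (u x : ℂ)) (Complex.ofRealCLM.comp (fderiv ℝ u x)) x :=
      Complex.ofRealCLM.hasFDerivAt.comp x
        ((hu.differentiable (by simp)) x).hasFDerivAt
    have h3 : (∂_{(EuclideanSpace.single i 1 : Euc d)} f) x
        = ((fderiv ℝ u x (EuclideanSpace.single i 1) : ℝ) : ℂ) := by
      rw [SchwartzMap.lineDerivOp_apply_eq_fderiv]
      change fderiv ℝ (fun x => (u x : ℂ)) x _ = _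
      rw [h2.fderiv]
      simp
    simp only [h3, Complex.norm_real, Real.norm_eq_abs, sq_abs]
  have hmass : ∫ ξ, ‖𝓕 f ξ‖ ^ 2 = ∫ x, (u x) ^ 2 := by
    rw [SchwartzMap.integral_norm_sq_fourier]
    simp [hfx]
  have hint0 := integrable_norm_sq (𝓕 f)
  have hgrad : ∫ x, ‖gradient u x‖ ^ 2 = ∫ ξ, 4 * π ^ 2 * ‖ξ‖ ^ 2 * ‖𝓕 f ξ‖ ^ 2 := by
    simp_rw [norm_gradient_sq_eq_sum]
    rw [integral_finsetSum]
    · simp_rw [← hD]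
      rw [← integral_finsetSum _ fun i _ => integrable_norm_sq _]
      refine integral_congr_ae (Filter.Eventually.of_forall fun ξ => ?_)
      simp only [hDpt, EuclideanSpace.norm_sq_eq, Real.norm_eq_abs, sq_abs]
      rw [Finset.mul_sum, Finset.sum_mul]
    · intro i _
      refine Continuous.integrable_of_hasCompactSupport ?_ ?_
      · exact ((hu.continuous_fderiv (by simp)).clm_apply continuous_const).pow 2
      · exact (huc.fderiv_apply ℝ _).comp_left (g := fun t : ℝ => t ^ 2) (by simp)
  have hint1 : Integrable fun ξ => 4 * π ^ 2 * ‖ξ‖ ^ 2 * ‖𝓕 f ξ‖ ^ 2 := by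
    have : Integrable fun ξ => ∑ i, ‖𝓕 (∂_{(EuclideanSpace.single i 1 : Euc d)} f) ξ‖ ^ 2 :=
      integrable_finsetSum _ fun i _ => integrable_norm_sq _
    refine this.congr (Filter.Eventually.of_forall fun ξ => ?_)
    simp only [hDpt, EuclideanSpace.norm_sq_eq, Real.norm_eq_abs, sq_abs]
    rw [Finset.mul_sum, Finset.sum_mul]
  have hsplit : ∀ ξ, (1 - 4 * π ^ 2 * h ^ 2 * ‖ξ‖ ^ 2) * ‖𝓕 f ξ‖ ^ 2
      = ‖𝓕 f ξ‖ ^ 2 - h ^ 2 * (4 * π ^ 2 * ‖ξ‖ ^ 2 * ‖𝓕 f ξ‖ ^ 2) := fun ξ => by ring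
  simp_rw [← hF, hsplit]
  refine ⟨hint0.sub (hint1.const_mul _), ?_⟩
  rw [integral_sub hint0 (hint1.const_mul _), integral_const_mul, hmass, hgrad]

/-- Bessel's inequality for a finite orthonormal family. -/
theorem sum_sq_integral_mul_le {d n : ℕ} (v : Fin n → Euc d → ℝ) (hv : ∀ j, Continuous (v j))
    (hvc : ∀ j, HasCompactSupport (v j))
    (horth : ∀ i j, (∫ x : Euc d, v i x * v j x) = if i = j then (1 : ℝ) else 0)
    (f : Euc d → ℝ) (hf : Continuous f) (hfc : HasCompactSupport f) :
    ∑ j, (∫ x, v j x * f x) ^ 2 ≤ ∫ x, f x ^ 2 := by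
  set c : Fin n → ℝ := fun j => ∫ x, v j x * f x with hc
  have h0 : 0 ≤ ∫ x, (f x - ∑ j, c j * v j x) ^ 2 := integral_nonneg fun x => sq_nonneg _
  have iv : ∀ i j, Integrable fun x => v i x * v j x := fun i j =>
    ((hv i).mul (hv j)).integrable_of_hasCompactSupport (hvc i).mul_right
  have ivf : ∀ j, Integrable fun x => v j x * f x := fun j =>
    ((hv j).mul hf).integrable_of_hasCompactSupport (hvc j).mul_right
  have iff : Integrable fun x => f x ^ 2 :=
    (hf.pow 2).integrable_of_hasCompactSupport (hasCompactSupport_sq hfc)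
  have hexp : ∀ x, (f x - ∑ j, c j * v j x) ^ 2 = f x ^ 2 - ∑ j, 2 * c j * (v j x * f x)
      + ∑ i, ∑ j, c i * c j * (v i x * v j x) := by
    intro x
    have h1 : (∑ j, c j * v j x) ^ 2 = ∑ i, ∑ j, c i * c j * (v i x * v j x) := by
      rw [pow_two, Finset.sum_mul_sum]
      exact Finset.sum_congr rfl fun i _ => Finset.sum_congr rfl fun j _ => by ring
    have h2 : ∑ j, 2 * c j * (v j x * f x) = 2 * f x * ∑ j, c j * v j x := by
      rw [Finset.mul_sum]
      exact Finset.sum_congr rfl fun i _ => by ring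
    rw [← h1, h2]
    ring
  have i1 : Integrable fun x => ∑ j, 2 * c j * (v j x * f x) :=
    integrable_finsetSum _ fun j _ => (ivf j).const_mul _
  have i2 : ∀ i, Integrable fun x => ∑ j, c i * c j * (v i x * v j x) := fun i =>
    integrable_finsetSum _ fun j _ => (iv i j).const_mul _
  have hval : ∫ x, (f x - ∑ j, c j * v j x) ^ 2 = (∫ x, f x ^ 2) - ∑ j, c j ^ 2 := by
    simp_rw [hexp]
    have i12 : Integrable fun x => f x ^ 2 - ∑ j, 2 * c j * (v j x * f x) := iff.sub i1
    rw [integral_add i12 (integrable_finsetSum _ fun i _ => i2 i), integral_sub iff i1,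
      integral_finsetSum _ fun j _ => (ivf j).const_mul _,
      integral_finsetSum _ fun i _ => i2 i]
    have h3 : ∀ i, ∫ x, ∑ j, c i * c j * (v i x * v j x) = c i ^ 2 := by
      intro i
      rw [integral_finsetSum _ fun j _ => (iv i j).const_mul _]
      simp_rw [integral_const_mul, horth]
      simp [pow_two]
    simp_rw [h3, integral_const_mul]
    have h4 : ∑ j, 2 * c j * ∫ x, v j x * f x = 2 * ∑ j, c j ^ 2 := by
      rw [Finset.mul_sum]
      exact Finset.sum_congr rfl fun j _ => by simp only [hc]; ring
    rw [h4]
    ring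
  rw [hval] at h0
  linarith

/-- The Berezin upper bound for a finite orthonormal family. -/
theorem sum_energy_le {d : ℕ} (hd : 0 < d) {h : ℝ} (hh : 0 < h)
    (φ : Euc d → ℝ) (hφ : ContDiff ℝ (⊤ : ℕ∞) φ) (hφc : HasCompactSupport φ)
    {n : ℕ} (v : Fin n → Euc d → ℝ) (hv : ∀ j, ContDiff ℝ (⊤ : ℕ∞) (v j))
    (hvc : ∀ j, HasCompactSupport (v j))
    (horth : ∀ i j, (∫ x : Euc d, v i x * v j x) = if i = j then (1 : ℝ) else 0) :
    ∑ j, ((∫ x : Euc d, (φ x) ^ 2 * (v j x) ^ 2)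
          - h ^ 2 * ∫ x : Euc d, ‖gradient (fun y => φ y * v j y) x‖ ^ 2)
      ≤ Lconst d * h ^ (-(d : ℝ)) * ∫ x, φ x ^ 2 := by
  set N : Fin n → Euc d → ℝ := fun j ξ => (∫ x, φ x * v j x * cos (2 * π * inner ℝ x ξ)) ^ 2
    + (∫ x, φ x * v j x * sin (2 * π * inner ℝ x ξ)) ^ 2 with hN
  set s : Euc d → ℝ := fun ξ => 1 - 4 * π ^ 2 * h ^ 2 * ‖ξ‖ ^ 2 with hs
  set R : ℝ := (2 * π * h)⁻¹ with hR
  have hN0 : ∀ j ξ, 0 ≤ N j ξ := fun j ξ => by positivity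
  have hpl := fun j => plancherel_energy h (fun y => φ y * v j y) (hφ.mul (hv j)) hφc.mul_right
  have hint : ∀ j, Integrable fun ξ => s ξ * N j ξ := fun j => (hpl j).1
  have hterm : ∀ j, (∫ x : Euc d, (φ x) ^ 2 * (v j x) ^ 2)
      - h ^ 2 * ∫ x : Euc d, ‖gradient (fun y => φ y * v j y) x‖ ^ 2 = ∫ ξ, s ξ * N j ξ := by
    intro j
    rw [← (hpl j).2]
    simp only [mul_pow]
  have hsplit : ∀ ξ : Euc d, s ξ = 1 - (2 * π * h * ‖ξ‖) ^ 2 := fun ξ => by simp only [hs]; ring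
  have hpos : 0 < 2 * π * h := by positivity
  have hs_nonneg : ∀ ξ ∈ ball (0 : Euc d) R, 0 ≤ s ξ := by
    intro ξ hξ
    rw [mem_ball_zero_iff, hR, ← one_div, lt_div_iff₀' hpos] at hξ
    rw [hsplit, sub_nonneg]
    exact pow_le_one₀ (by positivity) hξ.le
  have hs_nonpos : ∀ ξ ∉ ball (0 : Euc d) R, s ξ ≤ 0 := by
    intro ξ hξ
    rw [mem_ball_zero_iff, hR, ← one_div, lt_div_iff₀' hpos, not_lt] at hξ
    rw [hsplit, sub_nonpos]
    exact one_le_pow₀ hξ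
  have hbessel : ∀ ξ, ∑ j, N j ξ ≤ ∫ x, φ x ^ 2 := by
    intro ξ
    have hc := sum_sq_integral_mul_le v (fun j => (hv j).continuous) hvc horth
      (fun x => φ x * cos (2 * π * inner ℝ x ξ)) (hφ.continuous.mul (by fun_prop)) hφc.mul_right
    have hs' := sum_sq_integral_mul_le v (fun j => (hv j).continuous) hvc horth
      (fun x => φ x * sin (2 * π * inner ℝ x ξ)) (hφ.continuous.mul (by fun_prop)) hφc.mul_right
    have i2 : ∀ g : Euc d → ℝ, Continuous g → Integrable fun x => (φ x * g x) ^ 2 := fun g hg =>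
      ((hφ.continuous.mul hg).pow 2).integrable_of_hasCompactSupport
        (hasCompactSupport_sq hφc.mul_right)
    have hsum : (∫ x, (φ x * cos (2 * π * inner ℝ x ξ)) ^ 2)
        + (∫ x, (φ x * sin (2 * π * inner ℝ x ξ)) ^ 2) = ∫ x, φ x ^ 2 := by
      rw [← integral_add (i2 _ (by fun_prop)) (i2 _ (by fun_prop))]
      refine integral_congr_ae (Filter.Eventually.of_forall fun x => ?_)
      simp only [mul_pow, ← mul_add, Real.cos_sq_add_sin_sq, mul_one]
    have hr : ∀ j (g : Euc d → ℝ), ∫ x, φ x * v j x * g x = ∫ x, v j x * (φ x * g x) :=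
      fun j g => integral_congr_ae (Filter.Eventually.of_forall fun x => by ring)
    simp only [hN, Finset.sum_add_distrib, hr]
    linarith
  have hball : MeasurableSet (ball (0 : Euc d) R) := measurableSet_ball
  simp_rw [hterm]
  calc ∑ j, ∫ ξ, s ξ * N j ξ ≤ ∑ j, ∫ ξ in ball (0 : Euc d) R, s ξ * N j ξ := by
        refine Finset.sum_le_sum fun j _ => ?_
        rw [← integral_add_compl hball (hint j)]
        have : ∫ ξ in (ball (0 : Euc d) R)ᶜ, s ξ * N j ξ ≤ 0 :=
          setIntegral_nonpos hball.compl fun ξ hξ =>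
            mul_nonpos_of_nonpos_of_nonneg (hs_nonpos ξ hξ) (hN0 j ξ)
        linarith
    _ = ∫ ξ in ball (0 : Euc d) R, ∑ j, s ξ * N j ξ :=
        (integral_finsetSum _ fun j _ => (hint j).integrableOn).symm
    _ ≤ ∫ ξ in ball (0 : Euc d) R, s ξ * ∫ x, φ x ^ 2 := by
        refine setIntegral_mono_on (integrable_finsetSum _ fun j _ => (hint j).integrableOn) ?_
          hball fun ξ hξ => ?_
        · refine Integrable.mul_const ?_ _
          have : Continuous s := by fun_prop
          exact (this.continuousOn.integrableOn_compact (isCompact_closedBall 0 R)).mono_set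
            ball_subset_closedBall
        · rw [← Finset.mul_sum]
          exact mul_le_mul_of_nonneg_left (hbessel ξ) (hs_nonneg ξ hξ)
    _ = _ := by rw [integral_mul_const, setIntegral_ball_symbol hd hh]

theorem gradient_fun_add {d : ℕ} {u v : Euc d → ℝ} {x : Euc d} (hu : DifferentiableAt ℝ u x)
    (hv : DifferentiableAt ℝ v x) :
    gradient (fun y => u y + v y) x = gradient u x + gradient v x := by
  simp only [gradient, fderiv_fun_add hu hv, map_add]

theorem gradient_fun_const_mul {d : ℕ} {u : Euc d → ℝ} {x : Euc d} (hu : DifferentiableAt ℝ u x)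
    (c : ℝ) : gradient (fun y => c * u y) x = c • gradient u x := by
  simp only [gradient, fderiv_const_mul hu c, map_smul]

theorem gradient_fun_mul {d : ℕ} {u v : Euc d → ℝ} {x : Euc d} (hu : DifferentiableAt ℝ u x)
    (hv : DifferentiableAt ℝ v x) :
    gradient (fun y => u y * v y) x = u x • gradient v x + v x • gradient u x := by
  simp only [gradient, fderiv_fun_mul hu hv, map_add, map_smul]

theorem continuous_gradient {d : ℕ} {u : Euc d → ℝ} (hu : ContDiff ℝ (⊤ : ℕ∞) u) :
    Continuous (gradient u) :=
  (InnerProductSpace.toDual ℝ (Euc d)).symm.continuous.comp (hu.continuous_fderiv (by simp))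

theorem hasCompactSupport_gradient {d : ℕ} {u : Euc d → ℝ} (hu : HasCompactSupport u) :
    HasCompactSupport (gradient u) :=
  (hu.fderiv ℝ).comp_left (g := (InnerProductSpace.toDual ℝ (Euc d)).symm) (map_zero _)

theorem integrable_inner_gradient {d : ℕ} {u v : Euc d → ℝ} (hu : ContDiff ℝ (⊤ : ℕ∞) u)
    (hv : ContDiff ℝ (⊤ : ℕ∞) v) (huc : HasCompactSupport u) :
    Integrable fun x => inner ℝ (gradient u x) (gradient v x) := by
  refine ((continuous_gradient hu).inner (continuous_gradient hv)).integrable_of_hasCompactSupport ?_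
  refine (hasCompactSupport_gradient huc).mono fun x hx => ?_
  contrapose! hx
  rw [Function.mem_support, not_not] at hx ⊢
  rw [hx, inner_zero_left]

theorem integrable_norm_gradient_sq {d : ℕ} {u : Euc d → ℝ} (hu : ContDiff ℝ (⊤ : ℕ∞) u)
    (huc : HasCompactSupport u) : Integrable fun x => ‖gradient u x‖ ^ 2 := by
  simpa only [real_inner_self_eq_norm_sq] using integrable_inner_gradient hu hu huc

/-- The kinetic energies of `u cos` and `u sin` at frequency `ξ` add up as for `u e^{2πi⟨x,ξ⟩}`. -/
theorem integral_norm_gradient_cos_add_sin {d : ℕ} {u : Euc d → ℝ} (hu : ContDiff ℝ (⊤ : ℕ∞) u)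
    (huc : HasCompactSupport u) (ξ : Euc d) :
    (∫ x, ‖gradient (fun y => u y * cos (2 * π * inner ℝ y ξ)) x‖ ^ 2)
      + (∫ x, ‖gradient (fun y => u y * sin (2 * π * inner ℝ y ξ)) x‖ ^ 2)
      = (∫ x, ‖gradient u x‖ ^ 2) + 4 * π ^ 2 * ‖ξ‖ ^ 2 * ∫ x, u x ^ 2 := by
  have hp : ContDiff ℝ (⊤ : ℕ∞) fun y : Euc d => 2 * π * inner ℝ y ξ :=
    contDiff_const.mul (contDiff_id.inner ℝ contDiff_const)
  have hpx : ∀ x, HasFDerivAt (fun y : Euc d => 2 * π * inner ℝ y ξ)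
      ((2 * π) • innerSL ℝ ξ) x := by
    intro x
    have h1 := ((innerSL ℝ ξ).hasFDerivAt (x := x)).const_mul (2 * π)
    refine h1.congr_of_eventuallyEq (Filter.Eventually.of_forall fun y => ?_)
    simp [real_inner_comm]
  have hdual : (InnerProductSpace.toDual ℝ (Euc d)).symm (innerSL ℝ ξ) = ξ := by
    rw [LinearIsometryEquiv.symm_apply_eq]
    ext y
    simp
  have hgc : ∀ x, gradient (fun y : Euc d => cos (2 * π * inner ℝ y ξ)) x
      = (-(2 * π * sin (2 * π * inner ℝ x ξ))) • ξ := by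
    intro x
    rw [gradient, (hpx x).cos.fderiv, map_smul, map_smul, hdual, smul_smul]
    congr 1
    ring
  have hgs : ∀ x, gradient (fun y : Euc d => sin (2 * π * inner ℝ y ξ)) x
      = (2 * π * cos (2 * π * inner ℝ x ξ)) • ξ := by
    intro x
    rw [gradient, (hpx x).sin.fderiv, map_smul, map_smul, hdual, smul_smul]
    congr 1
    ring
  have hu2 : Integrable fun x => u x ^ 2 := (hu.continuous.pow 2).integrable_of_hasCompactSupport (hasCompactSupport_sq huc)
  rw [← integral_add
    (integrable_norm_gradient_sq (hu.mul hp.cos) huc.mul_right)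
    (integrable_norm_gradient_sq (hu.mul hp.sin) huc.mul_right),
    ← integral_const_mul, ← integral_add (integrable_norm_gradient_sq hu huc) (hu2.const_mul _)]
  refine integral_congr_ae (Filter.Eventually.of_forall fun x => ?_)
  have hud : DifferentiableAt ℝ u x := hu.differentiable (by simp) x
  simp only
  rw [gradient_fun_mul hud (hpx x).cos.differentiableAt,
    gradient_fun_mul hud (hpx x).sin.differentiableAt, hgc, hgs, smul_smul, smul_smul,
    norm_add_sq_real, norm_add_sq_real]
  simp only [norm_smul, mul_pow, Real.norm_eq_abs, sq_abs, inner_smul_left, inner_smul_right,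
    mul_neg, abs_neg, conj_trivial]
  linear_combination (4 * π ^ 2 * ‖ξ‖ ^ 2 * u x ^ 2 + ‖gradient u x‖ ^ 2)
    * (Real.sin_sq_add_cos_sq (2 * π * inner ℝ x ξ))

/-- The space of smooth compactly supported real functions on `ℝ^d`. -/
def testSpace (d : ℕ) : Submodule ℝ (Euc d → ℝ) where
  carrier := {v | TestFun Set.univ v}
  add_mem' hu hv := ⟨hu.1.add hv.1, hu.2.1.add hv.2.1, subset_univ _⟩
  zero_mem' := ⟨contDiff_const, HasCompactSupport.zero, subset_univ _⟩
  smul_mem' c _ hv := ⟨hv.1.const_smul c, hv.2.1.smul_left (f := fun _ => c), subset_univ _⟩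

theorem testSpace.integrable_mul {d : ℕ} (ψ : Euc d → ℝ) (hψ : Continuous ψ) (f g : testSpace d) :
    Integrable fun x => ψ x * (f.1 x * g.1 x) :=
  (hψ.mul (f.2.1.continuous.mul g.2.1.continuous)).integrable_of_hasCompactSupport
    (f.2.2.1.mul_right.mul_left)

/-- The bilinear form `(f, g) ↦ ∫ ψ f g` on test functions. -/
def massForm {d : ℕ} (ψ : Euc d → ℝ) (hψ : Continuous ψ) :
    testSpace d →ₗ[ℝ] testSpace d →ₗ[ℝ] ℝ :=
  LinearMap.mk₂ ℝ (fun f g => ∫ x, ψ x * (f.1 x * g.1 x))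
    (fun f f' g => by
      rw [← integral_add (testSpace.integrable_mul ψ hψ f g) (testSpace.integrable_mul ψ hψ f' g)]
      refine integral_congr_ae (Filter.Eventually.of_forall fun x => ?_)
      simp only [Submodule.coe_add, Pi.add_apply]
      ring)
    (fun c f g => by
      rw [smul_eq_mul, ← integral_const_mul]
      refine integral_congr_ae (Filter.Eventually.of_forall fun x => ?_)
      simp only [Submodule.coe_smul, Pi.smul_apply, smul_eq_mul]
      ring)
    (fun f g g' => by
      rw [← integral_add (testSpace.integrable_mul ψ hψ f g) (testSpace.integrable_mul ψ hψ f g')]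
      refine integral_congr_ae (Filter.Eventually.of_forall fun x => ?_)
      simp only [Submodule.coe_add, Pi.add_apply]
      ring)
    (fun c f g => by
      rw [smul_eq_mul, ← integral_const_mul]
      refine integral_congr_ae (Filter.Eventually.of_forall fun x => ?_)
      simp only [Submodule.coe_smul, Pi.smul_apply, smul_eq_mul]
      ring)

theorem massForm_apply {d : ℕ} (ψ : Euc d → ℝ) (hψ : Continuous ψ) (f g : testSpace d) :
    massForm ψ hψ f g = ∫ x, ψ x * (f.1 x * g.1 x) := rfl

theorem testSpace.gradient_mul_add {d : ℕ} {φ : Euc d → ℝ} (hφ : ContDiff ℝ (⊤ : ℕ∞) φ)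
    (f g : testSpace d) (x : Euc d) :
    gradient (fun y => φ y * (f + g).1 y) x
      = gradient (fun y => φ y * f.1 y) x + gradient (fun y => φ y * g.1 y) x := by
  have hd : ∀ u : testSpace d, DifferentiableAt ℝ (fun y => φ y * u.1 y) x := fun u =>
    (hφ.mul u.2.1).differentiable (by simp) x
  rw [← gradient_fun_add (hd f) (hd g)]
  simp only [Submodule.coe_add, Pi.add_apply, mul_add]

theorem testSpace.gradient_mul_smul {d : ℕ} {φ : Euc d → ℝ} (hφ : ContDiff ℝ (⊤ : ℕ∞) φ)
    (c : ℝ) (f : testSpace d) (x : Euc d) :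
    gradient (fun y => φ y * (c • f).1 y) x = c • gradient (fun y => φ y * f.1 y) x := by
  rw [← gradient_fun_const_mul ((hφ.mul f.2.1).differentiable (by simp) x)]
  simp only [Submodule.coe_smul, Pi.smul_apply, smul_eq_mul, mul_left_comm]

theorem testSpace.integrable_inner {d : ℕ} {φ : Euc d → ℝ} (hφ : ContDiff ℝ (⊤ : ℕ∞) φ)
    (f g : testSpace d) : Integrable fun x =>
      inner ℝ (gradient (fun y => φ y * f.1 y) x) (gradient (fun y => φ y * g.1 y) x) :=
  integrable_inner_gradient (hφ.mul f.2.1) (hφ.mul g.2.1) f.2.2.1.mul_left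

/-- The bilinear form `(f, g) ↦ ∫ ⟨∇(φ f), ∇(φ g)⟩` on test functions. -/
def kineticForm {d : ℕ} (φ : Euc d → ℝ) (hφ : ContDiff ℝ (⊤ : ℕ∞) φ) :
    testSpace d →ₗ[ℝ] testSpace d →ₗ[ℝ] ℝ :=
  LinearMap.mk₂ ℝ (fun f g => ∫ x, inner ℝ (gradient (fun y => φ y * f.1 y) x)
      (gradient (fun y => φ y * g.1 y) x))
    (fun f f' g => by
      simp_rw [testSpace.gradient_mul_add hφ, inner_add_left]
      exact integral_add (testSpace.integrable_inner hφ f g) (testSpace.integrable_inner hφ f' g))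
    (fun c f g => by
      simp_rw [testSpace.gradient_mul_smul hφ, inner_smul_left]
      exact integral_const_mul _ _)
    (fun f g g' => by
      simp_rw [testSpace.gradient_mul_add hφ, inner_add_right]
      exact integral_add (testSpace.integrable_inner hφ f g) (testSpace.integrable_inner hφ f g'))
    (fun c f g => by
      simp_rw [testSpace.gradient_mul_smul hφ, inner_smul_right]
      exact integral_const_mul _ _)

theorem kineticForm_self {d : ℕ} (φ : Euc d → ℝ) (hφ : ContDiff ℝ (⊤ : ℕ∞) φ) (f : testSpace d) :
    kineticForm φ hφ f f = ∫ x, ‖gradient (fun y => φ y * f.1 y) x‖ ^ 2 := by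
  simp_rw [← real_inner_self_eq_norm_sq]
  rfl

/-- The quadratic form of `φ (1 + h²Δ) φ`, as a bilinear form on test functions. -/
def energyForm {d : ℕ} (h : ℝ) (φ : Euc d → ℝ) (hφ : ContDiff ℝ (⊤ : ℕ∞) φ) :
    testSpace d →ₗ[ℝ] testSpace d →ₗ[ℝ] ℝ :=
  massForm (fun x => φ x ^ 2) (hφ.continuous.pow 2) - h ^ 2 • kineticForm φ hφ

theorem energyForm_self {d : ℕ} (h : ℝ) (φ : Euc d → ℝ) (hφ : ContDiff ℝ (⊤ : ℕ∞) φ)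
    (f : testSpace d) : energyForm h φ hφ f f = (∫ x, φ x ^ 2 * f.1 x ^ 2)
      - h ^ 2 * ∫ x, ‖gradient (fun y => φ y * f.1 y) x‖ ^ 2 := by
  simp only [energyForm, LinearMap.sub_apply, LinearMap.smul_apply, massForm_apply,
    kineticForm_self, smul_eq_mul, pow_two (f.1 _)]

/-- A finite family of test functions with Gram matrix at most `1` may be replaced by an
orthonormal one without decreasing the energy sum. -/
theorem exists_orthonormal_testFun_sum_le {d : ℕ} (h : ℝ) (φ : Euc d → ℝ)
    (hφ : ContDiff ℝ (⊤ : ℕ∞) φ) {ι : Type*} [Fintype ι] [DecidableEq ι] (g : ι → testSpace d)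
    (hg : ∀ c : ι → ℝ, ∫ x, (∑ k, c k * (g k).1 x) ^ 2 ≤ ∑ k, c k ^ 2) :
    ∃ (n : ℕ) (v : Fin n → Euc d → ℝ), (∀ i, TestFun Set.univ (v i)) ∧
      (∀ i j, (∫ x : Euc d, v i x * v j x) = if i = j then (1 : ℝ) else 0) ∧
      ∑ k, energyForm h φ hφ (g k) (g k) ≤ ∑ j, ((∫ x : Euc d, (φ x) ^ 2 * (v j x) ^ 2)
          - h ^ 2 * ∫ x : Euc d, ‖gradient (fun y => φ y * v j y) x‖ ^ 2) := by
  have hB : ∀ f g : testSpace d, massForm (fun _ => 1) continuous_const f g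
      = ∫ x, f.1 x * g.1 x := fun f g => by simp only [massForm_apply, one_mul]
  obtain ⟨n, v, hv, hle⟩ := exists_orthonormal_family_sum_le
    (massForm (d := d) (fun _ => 1) continuous_const) (energyForm h φ hφ)
    (fun f g => by simp only [hB, mul_comm])
    (fun f => by
      rw [hB]
      exact integral_nonneg fun x => mul_self_nonneg _)
    (fun f hf => by
      rw [hB] at hf
      have hi : Integrable fun x => f.1 x * f.1 x :=
        (f.2.1.continuous.mul f.2.1.continuous).integrable_of_hasCompactSupport f.2.2.1.mul_right
      rw [integral_eq_zero_iff_of_nonneg (fun x => mul_self_nonneg _) hi] at hf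
      have hf0 := ((f.2.1.continuous.mul f.2.1.continuous).ae_eq_iff_eq volume
        continuous_zero).1 hf
      ext x
      exact mul_self_eq_zero.1 (congrFun hf0 x))
    g
    (fun c => by
      rw [hB]
      refine le_trans (le_of_eq ?_) (hg c)
      refine integral_congr_ae (Filter.Eventually.of_forall fun x => ?_)
      simp only [Submodule.coe_sum, Submodule.coe_smul, Finset.sum_apply, Pi.smul_apply,
        smul_eq_mul, pow_two])
  refine ⟨n, fun j => (v j).1, fun j => (v j).2, fun i j => (hB _ _).symm.trans (hv i j), ?_⟩
  simpa only [← energyForm_self h φ hφ] using hle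

/-- Plane waves with frequencies in `n⁻¹ℤ^d`, truncated to a cube of side `n`, are almost
orthogonal. -/
theorem integral_sq_mul_sum_wave_le {d n : ℕ} (hn : 0 < n) (T : Finset (Fin d → ℝ))
    (hT : ∀ ξ ∈ T, ∀ i, ∃ m : ℤ, n * ξ i = m) (χ : Euc d → ℝ) (hχ1 : ∀ x, |χ x| ≤ 1)
    (hχ : ∀ x, χ x ≠ 0 → ∀ i, x i ∈ Set.Ioc (-(n : ℝ) / 2) (n / 2)) (p q : (Fin d → ℝ) → ℝ) :
    ∫ x, (χ x * ∑ ξ ∈ T, (p ξ * cos (2 * π * inner ℝ x (WithLp.toLp 2 ξ))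
      + q ξ * sin (2 * π * inner ℝ x (WithLp.toLp 2 ξ)))) ^ 2
      ≤ n ^ d * ∑ ξ ∈ T, (p ξ ^ 2 + q ξ ^ 2) := by
  set Z : (Fin d → ℝ) → ℂ := fun x => ∑ ξ ∈ T, (⟨p ξ, -q ξ⟩ : ℂ)
    * Complex.exp ((2 * π * ∑ i, x i * ξ i : ℝ) * Complex.I) with hZ
  set K : Set (Fin d → ℝ) := Set.univ.pi fun _ : Fin d => Set.Ioc (-(n : ℝ) / 2) (n / 2) with hK
  have hKm : MeasurableSet K := MeasurableSet.univ_pi fun _ => measurableSet_Ioc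
  have hZc : Continuous Z := by fun_prop
  have hre : ∀ x : Fin d → ℝ, (Z x).re = ∑ ξ ∈ T,
      (p ξ * cos (2 * π * inner ℝ (WithLp.toLp 2 x : Euc d) (WithLp.toLp 2 ξ))
      + q ξ * sin (2 * π * inner ℝ (WithLp.toLp 2 x : Euc d) (WithLp.toLp 2 ξ))) := by
    intro x
    have hin : ∀ ξ : Fin d → ℝ, inner ℝ (WithLp.toLp 2 x : Euc d) (WithLp.toLp 2 ξ)
        = ∑ i, x i * ξ i := fun ξ => by simp [PiLp.inner_apply, mul_comm]
    rw [hZ, Complex.re_sum]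
    refine Finset.sum_congr rfl fun ξ _ => ?_
    rw [Complex.mul_re, Complex.exp_ofReal_mul_I_re, Complex.exp_ofReal_mul_I_im, hin]
    ring
  have hint : IntegrableOn (fun x => ‖Z x‖ ^ 2) K := by
    have hcomp : IsCompact (Set.univ.pi fun _ : Fin d => Set.Icc (-(n : ℝ) / 2) (n / 2)) :=
      isCompact_univ_pi fun _ => isCompact_Icc
    exact ((hZc.norm.pow 2).continuousOn.integrableOn_compact hcomp).mono_set
      (Set.pi_mono fun _ _ => Set.Ioc_subset_Icc_self)
  rw [← (PiLp.volume_preserving_toLp (Fin d)).integral_comp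
    (MeasurableEquiv.toLp 2 (Fin d → ℝ)).measurableEmbedding]
  calc ∫ x : Fin d → ℝ, (χ (WithLp.toLp 2 x) * ∑ ξ ∈ T,
        (p ξ * cos (2 * π * inner ℝ (WithLp.toLp 2 x : Euc d) (WithLp.toLp 2 ξ))
        + q ξ * sin (2 * π * inner ℝ (WithLp.toLp 2 x : Euc d) (WithLp.toLp 2 ξ)))) ^ 2
      ≤ ∫ x, K.indicator (fun x => ‖Z x‖ ^ 2) x := by
        refine integral_mono_of_nonneg (Filter.Eventually.of_forall fun x => sq_nonneg _)
          (hint.integrable_indicator hKm) (Filter.Eventually.of_forall fun x => ?_)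
        simp only
        rw [← hre]
        by_cases hx : x ∈ K
        · rw [Set.indicator_of_mem hx, mul_pow, ← sq_abs (χ _), ← sq_abs (Z x).re]
          calc |χ (WithLp.toLp 2 x)| ^ 2 * |(Z x).re| ^ 2 ≤ 1 * |(Z x).re| ^ 2 := by
                gcongr
                exact pow_le_one₀ (abs_nonneg _) (hχ1 _)
            _ ≤ ‖Z x‖ ^ 2 := by
                rw [one_mul]
                gcongr
                exact Complex.abs_re_le_norm _
        · have : χ (WithLp.toLp 2 x) = 0 := by
            by_contra h0
            exact hx fun i _ => hχ _ h0 i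
          rw [Set.indicator_of_notMem hx, this]
          simp
    _ = n ^ d * ∑ ξ ∈ T, ‖(⟨p ξ, -q ξ⟩ : ℂ)‖ ^ 2 := by
        rw [integral_indicator hKm]
        exact integral_cube_norm_sq_sum_planeWave hn T hT fun ξ => ⟨p ξ, -q ξ⟩
    _ = n ^ d * ∑ ξ ∈ T, (p ξ ^ 2 + q ξ ^ 2) := by
        congr 1
        refine Finset.sum_congr rfl fun ξ _ => ?_
        rw [← Complex.normSq_eq_norm_sq, Complex.normSq_mk]
        ring

/-- The real and imaginary parts of a plane wave of frequency `ξ`, multiplied by `a χ`. -/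
def waveTestFun {d : ℕ} (a : ℝ) (χ : testSpace d) (ξ : Fin d → ℝ) (b : Bool) : testSpace d :=
  ⟨fun x => a * (χ.1 x * bif b then cos (2 * π * inner ℝ x (WithLp.toLp 2 ξ))
    else sin (2 * π * inner ℝ x (WithLp.toLp 2 ξ))), by
    have hp : ContDiff ℝ (⊤ : ℕ∞) fun y : Euc d => 2 * π * inner ℝ y (WithLp.toLp 2 ξ) :=
      contDiff_const.mul (contDiff_id.inner ℝ contDiff_const)
    refine ⟨?_, χ.2.2.1.mul_right.mul_left, subset_univ _⟩
    cases b
    · exact contDiff_const.mul (χ.2.1.mul hp.sin)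
    · exact contDiff_const.mul (χ.2.1.mul hp.cos)⟩

theorem energyForm_waveTestFun_add {d : ℕ} (h : ℝ) {φ : Euc d → ℝ} (hφ : ContDiff ℝ (⊤ : ℕ∞) φ)
    (hφc : HasCompactSupport φ) (a : ℝ) (χ : testSpace d) (hχ : ∀ x, φ x * χ.1 x = φ x)
    (ξ : Fin d → ℝ) :
    energyForm h φ hφ (waveTestFun a χ ξ true) (waveTestFun a χ ξ true)
      + energyForm h φ hφ (waveTestFun a χ ξ false) (waveTestFun a χ ξ false)
      = a ^ 2 * ((1 - 4 * π ^ 2 * h ^ 2 * ‖(WithLp.toLp 2 ξ : Euc d)‖ ^ 2) * (∫ x, φ x ^ 2)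
        - h ^ 2 * ∫ x, ‖gradient φ x‖ ^ 2) := by
  have hp : ContDiff ℝ (⊤ : ℕ∞) fun y : Euc d => 2 * π * inner ℝ y (WithLp.toLp 2 ξ) :=
    contDiff_const.mul (contDiff_id.inner ℝ contDiff_const)
  have key : ∀ g : Euc d → ℝ, ContDiff ℝ (⊤ : ℕ∞) g →
      (∫ x, φ x ^ 2 * (a * (χ.1 x * g x)) ^ 2) - h ^ 2 *
        ∫ x, ‖gradient (fun y => φ y * (a * (χ.1 y * g y))) x‖ ^ 2
      = a ^ 2 * ((∫ x, (φ x * g x) ^ 2) - h ^ 2 * ∫ x, ‖gradient (fun y => φ y * g y) x‖ ^ 2) := by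
    intro g hg
    have h1 : ∀ x, φ x * (a * (χ.1 x * g x)) = a * (φ x * g x) := fun x => by
      linear_combination a * g x * hχ x
    have h2 : ∀ x, φ x ^ 2 * (a * (χ.1 x * g x)) ^ 2 = a ^ 2 * (φ x * g x) ^ 2 := fun x => by
      rw [← mul_pow, h1, mul_pow]
    have h3 : ∀ x, ‖gradient (fun y => φ y * (a * (χ.1 y * g y))) x‖ ^ 2
        = a ^ 2 * ‖gradient (fun y => φ y * g y) x‖ ^ 2 := fun x => by
      simp_rw [h1]
      rw [gradient_fun_const_mul ((hφ.mul hg).differentiable (by simp) x), norm_smul, mul_pow,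
        Real.norm_eq_abs, sq_abs]
    simp_rw [h2, h3, integral_const_mul]
    ring
  have i2 : ∀ g : Euc d → ℝ, Continuous g → Integrable fun x => (φ x * g x) ^ 2 := fun g hg =>
    ((hφ.continuous.mul hg).pow 2).integrable_of_hasCompactSupport
      (hasCompactSupport_sq hφc.mul_right)
  have hsum : (∫ x, (φ x * cos (2 * π * inner ℝ x (WithLp.toLp 2 ξ))) ^ 2)
      + (∫ x, (φ x * sin (2 * π * inner ℝ x (WithLp.toLp 2 ξ))) ^ 2) = ∫ x, φ x ^ 2 := by
    rw [← integral_add (i2 _ hp.cos.continuous) (i2 _ hp.sin.continuous)]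
    refine integral_congr_ae (Filter.Eventually.of_forall fun x => ?_)
    simp only [mul_pow, ← mul_add, Real.cos_sq_add_sin_sq, mul_one]
  have hgrad := integral_norm_gradient_cos_add_sin hφ hφc (WithLp.toLp 2 ξ)
  rw [energyForm_self, energyForm_self]
  simp only [waveTestFun, cond_true, cond_false]
  rw [key _ hp.cos, key _ hp.sin]
  linear_combination a ^ 2 * hsum - a ^ 2 * h ^ 2 * hgrad

/-- The lower bound on the energy from the plane waves with frequencies in `T ⊆ n⁻¹ℤ^d`. -/
theorem exists_orthonormal_testFun_sum_lattice_le {d n : ℕ} (hn : 0 < n) (h : ℝ) {φ : Euc d → ℝ}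
    (hφ : ContDiff ℝ (⊤ : ℕ∞) φ) (hφc : HasCompactSupport φ) (χ : testSpace d)
    (hφχ : ∀ x, φ x * χ.1 x = φ x) (hχ1 : ∀ x, |χ.1 x| ≤ 1)
    (hχ : ∀ x, χ.1 x ≠ 0 → ∀ i, x i ∈ Set.Ioc (-(n : ℝ) / 2) (n / 2))
    (T : Finset (Fin d → ℝ)) (hT : ∀ ξ ∈ T, ∀ i, ∃ m : ℤ, n * ξ i = m) :
    ∃ (m : ℕ) (v : Fin m → Euc d → ℝ), (∀ i, TestFun Set.univ (v i)) ∧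
      (∀ i j, (∫ x : Euc d, v i x * v j x) = if i = j then (1 : ℝ) else 0) ∧
      (∑ ξ ∈ T, ((1 - 4 * π ^ 2 * h ^ 2 * ‖(WithLp.toLp 2 ξ : Euc d)‖ ^ 2) * (∫ x, φ x ^ 2)
        - h ^ 2 * ∫ x, ‖gradient φ x‖ ^ 2)) / (n : ℝ) ^ d
        ≤ ∑ j, ((∫ x : Euc d, (φ x) ^ 2 * (v j x) ^ 2)
          - h ^ 2 * ∫ x : Euc d, ‖gradient (fun y => φ y * v j y) x‖ ^ 2) := by
  classical
  have hn0 : (0 : ℝ) < (n : ℝ) ^ d := by positivity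
  set a : ℝ := (√((n : ℝ) ^ d))⁻¹ with ha
  have ha2 : a ^ 2 = ((n : ℝ) ^ d)⁻¹ := by rw [ha, inv_pow, Real.sq_sqrt hn0.le]
  obtain ⟨m, v, hv, hvo, hle⟩ := exists_orthonormal_testFun_sum_le h φ hφ
    (fun k : T × Bool => waveTestFun a χ k.1.1 k.2) (fun c => by
      set p : (Fin d → ℝ) → ℝ := fun ξ => if hξ : ξ ∈ T then c (⟨ξ, hξ⟩, true) else 0 with hp
      set q : (Fin d → ℝ) → ℝ := fun ξ => if hξ : ξ ∈ T then c (⟨ξ, hξ⟩, false) else 0 with hq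
      have hpc : ∀ ξ : T, p ξ = c (ξ, true) := fun ξ => by simp [hp]
      have hqc : ∀ ξ : T, q ξ = c (ξ, false) := fun ξ => by simp [hq]
      have h1 : ∀ x : Euc d, (∑ k : T × Bool, c k * (waveTestFun a χ k.1.1 k.2).1 x) ^ 2
          = a ^ 2 * (χ.1 x * ∑ ξ ∈ T, (p ξ * cos (2 * π * inner ℝ x (WithLp.toLp 2 ξ))
            + q ξ * sin (2 * π * inner ℝ x (WithLp.toLp 2 ξ)))) ^ 2 := by
        intro x
        rw [← mul_pow, Fintype.sum_prod_type, ← Finset.sum_coe_sort T, Finset.mul_sum,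
          Finset.mul_sum]
        congr 1
        refine Finset.sum_congr rfl fun ξ _ => ?_
        simp only [Fintype.sum_bool, hpc, hqc, waveTestFun, cond_true, cond_false]
        ring
      have h2 : ∑ k : T × Bool, c k ^ 2 = ∑ ξ ∈ T, (p ξ ^ 2 + q ξ ^ 2) := by
        rw [Fintype.sum_prod_type, ← Finset.sum_coe_sort T]
        simp only [Fintype.sum_bool, hpc, hqc]
      simp_rw [h1, h2, integral_const_mul]
      rw [ha2, inv_mul_le_iff₀ hn0]
      exact integral_sq_mul_sum_wave_le hn T hT χ.1 hχ1 hχ p q)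
  refine ⟨m, v, hv, hvo, le_trans (le_of_eq ?_) hle⟩
  rw [Fintype.sum_prod_type]
  simp only [Fintype.sum_bool, energyForm_waveTestFun_add h hφ hφc a χ hφχ]
  rw [Finset.sum_coe_sort T fun ξ => a ^ 2 * ((1 - 4 * π ^ 2 * h ^ 2
    * ‖(WithLp.toLp 2 ξ : Euc d)‖ ^ 2) * (∫ x, φ x ^ 2) - h ^ 2 * ∫ x, ‖gradient φ x‖ ^ 2),
    ← Finset.mul_sum, ha2, div_eq_inv_mul]

/-- A compactly supported function has a test function equal to one on its support. -/
theorem exists_cutoff {d : ℕ} {φ : Euc d → ℝ} (hφc : HasCompactSupport φ) :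
    ∃ χ : testSpace d, (∀ x, φ x * χ.1 x = φ x) ∧ (∀ x, |χ.1 x| ≤ 1) ∧
      ∃ r : ℝ, ∀ x, χ.1 x ≠ 0 → ‖x‖ < r := by
  obtain ⟨r, hr0, hr⟩ := hφc.isBounded.subset_closedBall_lt 0 (0 : Euc d)
  let b : ContDiffBump (0 : Euc d) := ⟨r, r + 1, hr0, lt_add_one r⟩
  refine ⟨⟨b, b.contDiff, b.hasCompactSupport, subset_univ _⟩, fun x => ?_, fun x => ?_, r + 1,
    fun x hx => ?_⟩
  · by_cases h0 : φ x = 0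
    · rw [h0, zero_mul]
    · have hx : x ∈ closedBall (0 : Euc d) b.rIn := hr (subset_tsupport φ h0)
      simp only [b.one_of_mem_closedBall hx, mul_one]
  · rw [abs_of_nonneg b.nonneg]
    exact b.le_one
  · have : x ∈ Function.support b := hx
    rw [b.support_eq] at this
    exact mem_ball_zero_iff.1 this

/-- The set of energy sums of finite orthonormal families of test functions. -/
def energySums {d : ℕ} (h : ℝ) (φ : Euc d → ℝ) : Set ℝ :=
  { S : ℝ | ∃ (n : ℕ) (v : Fin n → Euc d → ℝ),
    (∀ i, TestFun Set.univ (v i)) ∧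
    (∀ i j, (∫ x : Euc d, v i x * v j x) = if i = j then (1:ℝ) else 0) ∧
    S = ∑ j, ((∫ x : Euc d, (φ x)^2 * (v j x)^2)
          - h^2 * ∫ x : Euc d, ‖gradient (fun y => φ y * v j y) x‖^2) }

theorem le_of_mem_energySums {d : ℕ} (hd : 0 < d) {h : ℝ} (hh : 0 < h) {φ : Euc d → ℝ}
    (hφ : ContDiff ℝ (⊤ : ℕ∞) φ) (hφc : HasCompactSupport φ) {S : ℝ} (hS : S ∈ energySums h φ) :
    S ≤ Lconst d * h ^ (-(d : ℝ)) * ∫ x, φ x ^ 2 := by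
  obtain ⟨n, v, hv, hvo, rfl⟩ := hS
  exact sum_energy_le hd hh φ hφ hφc v (fun j => (hv j).1) (fun j => (hv j).2.1) hvo

theorem trNeg_univ_le {d : ℕ} (hd : 0 < d) {h : ℝ} (hh : 0 < h) {φ : Euc d → ℝ}
    (hφ : ContDiff ℝ (⊤ : ℕ∞) φ) (hφc : HasCompactSupport φ) :
    trNeg Set.univ h φ ≤ Lconst d * h ^ (-(d : ℝ)) * ∫ x, φ x ^ 2 :=
  csSup_le (s := energySums h φ) ⟨_, 0, fun _ _ => 0, Fin.rec0, Fin.rec0, rfl⟩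
    fun _ hS => le_of_mem_energySums hd hh hφ hφc hS

theorem le_trNeg_univ {d : ℕ} (hd : 0 < d) {h : ℝ} (hh : 0 < h) {φ : Euc d → ℝ}
    (hφ : ContDiff ℝ (⊤ : ℕ∞) φ) (hφc : HasCompactSupport φ) :
    Lconst d * h ^ (-(d : ℝ)) * (∫ x, φ x ^ 2) - ((2 * π) ^ d)⁻¹ * ballVol d
      * h ^ (-(d : ℝ) + 2) * ∫ x, ‖gradient φ x‖ ^ 2 ≤ trNeg Set.univ h φ := by
  obtain ⟨χ, hφχ, hχ1, r, hr⟩ := exists_cutoff hφc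
  set R : ℝ := (2 * π * h)⁻¹ with hR
  have hR0 : 0 < R := by positivity
  have hsc : Continuous fun ξ : Euc d => 1 - 4 * π ^ 2 * h ^ 2 * ‖ξ‖ ^ 2 := by fun_prop
  set c : Euc d → ℝ := fun ξ => (1 - 4 * π ^ 2 * h ^ 2 * ‖ξ‖ ^ 2) * (∫ x, φ x ^ 2)
    - h ^ 2 * ∫ x, ‖gradient φ x‖ ^ 2 with hc
  have hcc : Continuous c := (hsc.mul continuous_const).sub continuous_const
  obtain ⟨T, hT, hlim⟩ := exists_tendsto_sum_lattice_ball R c hcc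
  have hval : ∫ ξ in ball (0 : Euc d) R, c ξ = Lconst d * h ^ (-(d : ℝ)) * (∫ x, φ x ^ 2)
      - ((2 * π) ^ d)⁻¹ * ballVol d * h ^ (-(d : ℝ) + 2) * ∫ x, ‖gradient φ x‖ ^ 2 := by
    have hi : IntegrableOn (fun ξ : Euc d => 1 - 4 * π ^ 2 * h ^ 2 * ‖ξ‖ ^ 2)
        (ball (0 : Euc d) R) :=
      (hsc.continuousOn.integrableOn_compact (isCompact_closedBall 0 R)).mono_set
        ball_subset_closedBall
    have hpow : h ^ 2 * R ^ d = ((2 * π) ^ d)⁻¹ * h ^ (-(d : ℝ) + 2) := by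
      rw [Real.rpow_add hh, Real.rpow_neg hh.le, Real.rpow_natCast, Real.rpow_two, hR, inv_pow,
        mul_pow (2 * π) h d, mul_inv]
      ring
    rw [hc, integral_sub (hi.mul_const _) (integrableOn_const measure_ball_lt_top.ne), integral_mul_const,
      setIntegral_ball_symbol hd hh, setIntegral_const, volume_real_ball d hR0, smul_eq_mul]
    linear_combination (-ballVol d * ∫ x, ‖gradient φ x‖ ^ 2) * hpow
  rw [← hval]
  refine le_of_tendsto hlim ?_
  filter_upwards [Filter.eventually_gt_atTop (max 0 ⌈2 * r⌉₊)] with n hn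
  have hn0 : 0 < n := (le_max_left _ _).trans_lt hn
  have hnr : 2 * r < n := (Nat.le_ceil _).trans_lt (by exact_mod_cast (le_max_right _ _).trans_lt hn)
  obtain ⟨m, v, hv, hvo, hle⟩ := exists_orthonormal_testFun_sum_lattice_le hn0 h hφ hφc χ hφχ hχ1
    (fun x hx i => by
      have h1 := abs_lt.1 ((PiLp.norm_apply_le x i).trans_lt (hr x hx))
      exact ⟨by linarith, by linarith⟩) (T n) (hT n hn0)
  exact hle.trans (le_csSup (s := energySums h φ)
    ⟨_, fun _ hS => le_of_mem_energySums hd hh hφ hφc hS⟩ ⟨m, v, hv, hvo, rfl⟩)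

/-- whole-space two-sided bound.  For H₀ = -h²Δ - 1 on ℝ^d and real
φ ∈ C₀^∞(ℝ^d),
Tr(φH₀φ)_- ≥ L_d h^{-d} ∫ φ² - (2π)^{-d} ω_d h^{-d+2} ∫ |∇φ|², and combined with
the Berezin upper bound, |Tr(φH₀φ)_- - L_d h^{-d} ∫ φ²| ≤ (2π)^{-d} ω_d h^{-d+2} ∫ |∇φ|². -/
theorem whole_space_two_sided_bound
    (d : ℕ) (hd : 2 ≤ d) (h : ℝ) (hh : 0 < h)
    (φ : Euc d → ℝ) (hφ : ContDiff ℝ (⊤ : ℕ∞) φ) (hφc : HasCompactSupport φ) :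
    trNeg (Set.univ : Set (Euc d)) h φ
      ≥ Lconst d * h ^ (-(d:ℝ)) * (∫ x : Euc d, (φ x)^2)
        - ((2 * π) ^ d)⁻¹ * ballVol d * h ^ (-(d:ℝ) + 2)
          * ∫ x : Euc d, ‖gradient φ x‖^2 ∧
    |trNeg (Set.univ : Set (Euc d)) h φ
        - Lconst d * h ^ (-(d:ℝ)) * ∫ x : Euc d, (φ x)^2|
      ≤ ((2 * π) ^ d)⁻¹ * ballVol d * h ^ (-(d:ℝ) + 2)
          * ∫ x : Euc d, ‖gradient φ x‖^2 := by
  have hd0 : 0 < d := two_pos.trans_le hd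
  have hlow := le_trNeg_univ hd0 hh hφ hφc
  have hup := trNeg_univ_le hd0 hh hφ hφc
  have hgrad : 0 ≤ ((2 * π) ^ d)⁻¹ * ballVol d * h ^ (-(d : ℝ) + 2)
      * ∫ x : Euc d, ‖gradient φ x‖ ^ 2 := by
    have : 0 ≤ ballVol d := ENNReal.toReal_nonneg
    have : 0 ≤ ∫ x : Euc d, ‖gradient φ x‖ ^ 2 := integral_nonneg fun x => sq_nonneg _
    positivity
  exact ⟨hlow, abs_le.2 ⟨by linarith, by linarith⟩⟩
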